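/- Let V be a real symmetric positive-definite 2N×2N matrix, J the 2N×2N symplectic form, and D(V) = γ_L·(J B V + V B J − J A J) + γ_U·Σ_j κ_j (K_j V K_jᵀ − V) the symplectic-picture dissipator (with γ_L, γ_U ≥ 0, A = Re(C†C), B = Im(C†C), κ_j ≥ 0 summing to 1, and K_j real symplectic). If there exists a real symmetric matrix G with JGV − VGJ + D(V) = 0, then for every k ∈ {1,…,2N}: Tr( (J·D(V)) · (J V)^{k−1} ) = 0. -/

import Mathlib

open Matrix

theorem sq_eq_neg_one_of_symplectic_entries {N : ℕ}
    (J : Matrix (Fin (2*N)) (Fin (2*N)) ℝ)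
    (hJ : ∀ i j : Fin (2*N), J i j =
      if (j : ℕ) = (i : ℕ) + 1 ∧ (i : ℕ) % 2 = 0 then 1
      else if (i : ℕ) = (j : ℕ) + 1 ∧ (j : ℕ) % 2 = 0 then -1 else 0) :
    J * J = -1 := by
  ext i j
  have hi := i.isLt
  obtain ⟨p, hp⟩ : ∃ p : Fin (2*N),
      (p : ℕ) = if (i : ℕ) % 2 = 0 then (i : ℕ) + 1 else (i : ℕ) - 1 :=
    ⟨⟨if (i : ℕ) % 2 = 0 then (i : ℕ) + 1 else (i : ℕ) - 1, by split_ifs <;> omega⟩, rfl⟩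
  rw [Matrix.mul_apply, Finset.sum_eq_single p]
  · rw [hJ, hJ, Matrix.neg_apply, Matrix.one_apply]
    simp only [Fin.ext_iff]
    split_ifs at hp ⊢ <;> first | omega | norm_num
  · intro k _ hk
    have hk' : (k : ℕ) ≠ p := fun h => hk (Fin.ext h)
    rw [hJ i k, if_neg, if_neg, zero_mul] <;> split_ifs at hp <;> omega
  · simp

theorem trace_hamiltonian_mul_pow_eq_zero {n R : Type*} [Fintype n] [DecidableEq n] [CommRing R]
    (J V G : Matrix n n R) (hJ : J * J = -1) (k : ℕ) :
    ((J * (V * G * J - J * G * V)) * (J * V) ^ k).trace = 0 := by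
  have hsplit : (J * (V * G * J - J * G * V)) * (J * V) ^ k
      = (J * V) * (G * J * (J * V) ^ k) - (J * J) * (G * V * (J * V) ^ k) := by
    noncomm_ring
  have hcycle : G * J * (J * V) ^ k * (J * V) = (G * (J * J)) * (V * (J * V) ^ k) := by
    rw [Matrix.mul_assoc (G * J), ← pow_succ, pow_succ']
    simp only [Matrix.mul_assoc]
  rw [hsplit, Matrix.trace_sub, Matrix.trace_mul_comm (J * V), hcycle, hJ]
  simp [Matrix.mul_assoc]

theorem stmt_14 {N m mc : ℕ}
    (V : Matrix (Fin (2*N)) (Fin (2*N)) ℝ) (hVpos : V.PosDef) (hVsymm : Vᵀ = V)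
    (J : Matrix (Fin (2*N)) (Fin (2*N)) ℝ)
    (hJ : ∀ i j : Fin (2*N), J i j =
      if (j : ℕ) = (i : ℕ) + 1 ∧ (i : ℕ) % 2 = 0 then 1
      else if (i : ℕ) = (j : ℕ) + 1 ∧ (j : ℕ) % 2 = 0 then -1 else 0)
    (γL γU : ℝ) (hγL : 0 ≤ γL) (hγU : 0 ≤ γU)
    (C : Matrix (Fin mc) (Fin (2*N)) ℂ)
    (A B : Matrix (Fin (2*N)) (Fin (2*N)) ℝ)
    (hA : A = (Cᴴ * C).map Complex.re) (hB : B = (Cᴴ * C).map Complex.im)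
    (κ : Fin m → ℝ) (hκ : ∀ j, 0 ≤ κ j) (hκsum : ∑ j, κ j = 1)
    (K : Fin m → Matrix (Fin (2*N)) (Fin (2*N)) ℝ)
    (hK : ∀ j, K j * J * (K j)ᵀ = J)
    (DV : Matrix (Fin (2*N)) (Fin (2*N)) ℝ)
    (hDV : DV = γL • (J * B * V + V * B * J - J * A * J)
      + γU • ∑ j, κ j • (K j * V * (K j)ᵀ - V))
    (G : Matrix (Fin (2*N)) (Fin (2*N)) ℝ) (hGsymm : Gᵀ = G)
    (hstab : J * G * V - V * G * J + DV = 0) :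
    ∀ k ∈ Finset.Icc 1 (2*N), ((J * DV) * (J * V) ^ (k - 1)).trace = 0 := by
  intro k _
  have hD : DV = V * G * J - J * G * V := by
    rw [eq_neg_of_add_eq_zero_right hstab, neg_sub]
  rw [hD]
  exact trace_hamiltonian_mul_pow_eq_zero J V G
    (sq_eq_neg_one_of_symplectic_entries J hJ) (k - 1)
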